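/- Let A be a ring, G = G(A_A) the Goldie radical of the module A_A (which is a two-sided ideal of A), h : A → A/G the natural ring epimorphism, and X a non-singular right A-module (so XG = 0 and X is naturally a right h(A)-module). Then X is an injective h(A)-module if and only if X is an injective A-module. -/

import Mathlib

open MulOpposite

open MulOpposite

/-- The right annihilator `r(x) = {a : A | x·a = 0}` of an element `x` of a right `A`-module `X`,
as a right ideal of `A`. -/
def rightAnn (A : Type*) [Ring A] {X : Type*} [AddCommGroup X] [Module Aᵐᵒᵖ X]
    (x : X) : Submodule Aᵐᵒᵖ A where
  carrier := {a : A | op a • x = 0}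
  add_mem' := by
    intro a b ha hb
    simp only [Set.mem_setOf_eq] at *
    rw [op_add, add_smul, ha, hb, add_zero]
  zero_mem' := by simp
  smul_mem' := by
    intro c a ha
    simp only [Set.mem_setOf_eq] at *
    have h1 : c • a = a * c.unop := rfl
    rw [h1]
    have h2 : op (a * c.unop) = c * op a := by
      simp [MulOpposite.op_mul]
    rw [h2, mul_smul, ha, smul_zero]

/-- A right ideal `B` of `A` is essential if it has non-zero intersection with every
non-zero right ideal of `A`. -/
def IsEssentialRightIdeal (A : Type*) [Ring A] (B : Submodule Aᵐᵒᵖ A) : Prop :=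
  ∀ C : Submodule Aᵐᵒᵖ A, C ≠ ⊥ → B ⊓ C ≠ ⊥

/-- A right `A`-module `X` is non-singular if its singular submodule is zero, i.e. the only
element of `X` whose right annihilator is an essential right ideal of `A` is `0`. -/
def IsNonsingularMod (A : Type*) [Ring A] (X : Type*) [AddCommGroup X] [Module Aᵐᵒᵖ X] : Prop :=
  ∀ x : X, IsEssentialRightIdeal A (rightAnn A x) → x = 0

/-- The Goldie radical (second singular submodule) `G(X)` of a right `A`-module `X`: the
intersection of all submodules `Y ⊆ X` such that `X/Y` is non-singular. -/
def goldieRadical (A : Type*) [Ring A] (X : Type*) [AddCommGroup X] [Module Aᵐᵒᵖ X] :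
    Submodule Aᵐᵒᵖ X :=
  sInf {Y : Submodule Aᵐᵒᵖ X | IsNonsingularMod A (X ⧸ Y)}

/-- A module `X` is injective with respect to a module `Y` (`Y`-injective) if every homomorphism
from a submodule of `Y` to `X` extends to a homomorphism `Y → X`. -/
def IsInjectiveWrt (R : Type*) [Ring R] (X : Type*) [AddCommGroup X] [Module R X]
    (Y : Type*) [AddCommGroup Y] [Module R Y] : Prop :=
  ∀ (Y₁ : Submodule R Y) (f : Y₁ →ₗ[R] X), ∃ g : Y →ₗ[R] X, ∀ y : Y₁, g y = f y

/-- A ring `A` is right strongly semiprime if every two-sided ideal of `A` which is essential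
as a right ideal contains a finite subset with zero right annihilator. -/
def IsRightStronglySemiprime (A : Type*) [Ring A] : Prop :=
  ∀ T : TwoSidedIdeal A,
    (∀ C : Submodule Aᵐᵒᵖ A, C ≠ ⊥ → ∃ x ∈ C, x ≠ 0 ∧ x ∈ T) →
    ∃ K : Finset A, (K : Set A) ⊆ (T : Set A) ∧ ∀ a : A, (∀ k ∈ K, k * a = 0) → a = 0


lemma ess_mono13 {A : Type*} [Ring A] {B B' : Submodule Aᵐᵒᵖ A} (h : B ≤ B')
    (hB : IsEssentialRightIdeal A B) : IsEssentialRightIdeal A B' := by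
  intro C hC h0
  apply hB C hC
  rw [eq_bot_iff, ← h0]
  exact inf_le_inf_right _ h

lemma ess_smul13 {A : Type*} [Ring A] {X : Type*} [AddCommGroup X] [Module Aᵐᵒᵖ X]
    (x : X) (a : A) (h : IsEssentialRightIdeal A (rightAnn A x)) :
    IsEssentialRightIdeal A (rightAnn A (op a • x)) := by
  intro C hC h0
  obtain ⟨c, hc, hc0⟩ := C.ne_bot_iff.1 hC
  let D : Submodule Aᵐᵒᵖ A := C.map
    ({ toFun := fun b => a * b
       map_add' := mul_add a
       map_smul' := fun r b => (mul_assoc a b r.unop).symm } : A →ₗ[Aᵐᵒᵖ] A)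
  have key : ∀ d ∈ C, op (a * d) • x = 0 → d = 0 := by
    intro d hd hx
    have : d ∈ rightAnn A (op a • x) ⊓ C := by
      refine ⟨?_, hd⟩
      change op d • op a • x = 0
      rw [← mul_smul, ← op_mul]; exact hx
    rw [h0] at this
    simpa using this
  have hD : D ≠ ⊥ := by
    intro hD
    have : a * c ∈ D := ⟨c, hc, rfl⟩
    rw [hD, Submodule.mem_bot] at this
    exact hc0 (key c hc (by rw [this]; simp))
  apply h D hD
  rw [eq_bot_iff]
  rintro _ ⟨h1, d, hd, rfl⟩
  have : d = 0 := key d hd h1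
  subst this
  simp

lemma goldie_kill13 {A : Type*} [Ring A] {X : Type*} [AddCommGroup X] [Module Aᵐᵒᵖ X]
    (hX : IsNonsingularMod A X) (a : A) (ha : a ∈ goldieRadical A A) (x : X) :
    op a • x = 0 := by
  have : IsNonsingularMod A (A ⧸ rightAnn A x) := by
    intro z hz
    obtain ⟨b, rfl⟩ := Submodule.Quotient.mk_surjective _ z
    rw [Submodule.Quotient.mk_eq_zero]
    change op b • x = 0
    apply hX
    refine ess_mono13 ?_ hz
    intro c hc
    change op c • (Submodule.Quotient.mk b : A ⧸ rightAnn A x) = 0 at hc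
    rw [← Submodule.Quotient.mk_smul, Submodule.Quotient.mk_eq_zero] at hc
    change op (b * c) • x = 0 at hc
    change op c • op b • x = 0
    rw [← mul_smul, ← op_mul]; exact hc
  exact (Submodule.mem_sInf.1 ha) _ this

lemma exists_quot13 {A : Type*} [Ring A] {X : Type*} [AddCommGroup X] [Module Aᵐᵒᵖ X]
    (hX : IsNonsingularMod A X) {Y₁ Y : Type*} [AddCommGroup Y₁] [Module Aᵐᵒᵖ Y₁]
    [AddCommGroup Y] [Module Aᵐᵒᵖ Y] (f : Y₁ →ₗ[Aᵐᵒᵖ] Y)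
    (hf : Function.Injective f) (g : Y₁ →ₗ[Aᵐᵒᵖ] X) :
    ∃ N : Submodule Aᵐᵒᵖ Y, (∀ y, f y ∈ N → g y = 0) ∧ IsNonsingularMod A (Y ⧸ N) := by
  obtain ⟨N, hN⟩ := zorn_le₀ {N : Submodule Aᵐᵒᵖ Y | ∀ y, f y ∈ N → g y = 0} (by
    intro c hc hch
    rcases c.eq_empty_or_nonempty with rfl | hne
    · refine ⟨⊥, ?_, by simp⟩
      intro y hy
      have : y = 0 := hf (by simpa using hy)
      simp [this]
    · refine ⟨sSup c, ?_, fun z hz => le_sSup hz⟩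
      intro y hy
      obtain ⟨p, hp, hyp⟩ := (Submodule.mem_sSup_of_directed hne hch.directedOn).1 hy
      exact hc hp y hyp)
  refine ⟨N, hN.1, ?_⟩
  intro z hz
  obtain ⟨y, rfl⟩ := Submodule.Quotient.mk_surjective _ z
  rw [Submodule.Quotient.mk_eq_zero]
  have hle : N ≤ N ⊔ Submodule.span Aᵐᵒᵖ {y} := le_sup_left
  suffices h : (N ⊔ Submodule.span Aᵐᵒᵖ {y}) ∈
      {N : Submodule Aᵐᵒᵖ Y | ∀ y, f y ∈ N → g y = 0} from
    hN.2 h hle (Submodule.mem_sup_right (Submodule.mem_span_singleton_self y))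
  intro w hw
  obtain ⟨n, hn, s, hs, hns⟩ := Submodule.mem_sup.1 hw
  obtain ⟨a, rfl⟩ := Submodule.mem_span_singleton.1 hs
  apply hX
  refine ess_mono13 ?_ (ess_smul13 _ a.unop hz)
  intro b hb
  change op b • a • (Submodule.Quotient.mk y : Y ⧸ N) = 0 at hb
  rw [← Submodule.Quotient.mk_smul, ← Submodule.Quotient.mk_smul,
    Submodule.Quotient.mk_eq_zero] at hb
  change op b • g w = 0
  rw [← map_smul]
  apply hN.1
  rw [map_smul, ← hns, smul_add]
  exact N.add_mem (N.smul_mem _ hn) hb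

/-- The module structure over the quotient ring on a module killed by `G`. -/
lemma exists_mod13 {A : Type*} [Ring A] (G : TwoSidedIdeal A) (Z : Type*) [AddCommGroup Z]
    [Module Aᵐᵒᵖ Z] (h : ∀ a ∈ G, ∀ z : Z, op a • z = 0) :
    ∃ m : Module (G.ringCon.Quotient)ᵐᵒᵖ Z,
      ∀ (a : A) (z : Z), op (RingCon.mk' G.ringCon a) • z = op a • z := by
  have hs : Function.Surjective (RingCon.mk' G.ringCon) := RingCon.mk'_surjective _
  let sm : SMul (G.ringCon.Quotient)ᵐᵒᵖ Z :=
    ⟨fun s z => op (Function.surjInv hs s.unop) • z⟩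
  have key : ∀ (a : A) (z : Z), op (RingCon.mk' G.ringCon a) • z = op a • z := by
    intro a z
    change op (Function.surjInv hs (RingCon.mk' G.ringCon a)) • z = op a • z
    rw [← sub_eq_zero, ← sub_smul, ← op_sub]
    apply h
    have h1 := Function.surjInv_eq hs (RingCon.mk' G.ringCon a)
    have h2 := (RingCon.eq G.ringCon).1 h1
    exact (TwoSidedIdeal.rel_iff G _ _).1 h2
  exact ⟨Function.Surjective.moduleLeft (RingHom.op (RingCon.mk' G.ringCon))
    (fun s => ⟨op (Function.surjInv hs s.unop), unop_injective (Function.surjInv_eq hs _)⟩)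
    (fun c z => key c.unop z), key⟩

/-- For a non-singular right `A`-module `X`, naturally a module over `A/G` where
`G = G(A_A)`: `X` is an injective `A/G`-module iff `X` is an injective `A`-module. -/
theorem stmt13 (A : Type u) [Ring A] (G : TwoSidedIdeal A)
    (hG : ∀ x : A, x ∈ G ↔ x ∈ goldieRadical A A)
    (X : Type v) [AddCommGroup X] [Module Aᵐᵒᵖ X]
    (hX : IsNonsingularMod A X)
    (mX : Module (G.ringCon.Quotient)ᵐᵒᵖ X) :
    letI := mX
    (∀ (a : A) (x : X), op (RingCon.mk' G.ringCon a) • x = op a • x) →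
      (Module.Injective (G.ringCon.Quotient)ᵐᵒᵖ X ↔ Module.Injective Aᵐᵒᵖ X) := by
  intro hc
  have hs : Function.Surjective (RingCon.mk' G.ringCon) := RingCon.mk'_surjective _
  constructor
  · intro hI
    refine ⟨?_⟩
    intro Y₁ Y _ _ _ _ f hf g
    obtain ⟨N, hN, hns⟩ := exists_quot13 hX f hf g
    obtain ⟨m, hm⟩ := exists_mod13 G (Y ⧸ N)
      (fun a ha z => goldie_kill13 hns a ((hG a).1 ha) z)
    let W : Submodule Aᵐᵒᵖ Y₁ := N.comap f
    obtain ⟨m1, hm1⟩ := exists_mod13 G (Y₁ ⧸ W) (by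
      intro a ha z
      obtain ⟨y, rfl⟩ := Submodule.Quotient.mk_surjective _ z
      rw [← Submodule.Quotient.mk_smul, Submodule.Quotient.mk_eq_zero]
      change f (op a • y) ∈ N
      rw [map_smul, ← Submodule.Quotient.mk_eq_zero, Submodule.Quotient.mk_smul]
      exact goldie_kill13 hns a ((hG a).1 ha) _)
    let F : (Y₁ ⧸ W) →ₗ[Aᵐᵒᵖ] (Y ⧸ N) := W.mapQ N f le_rfl
    let K : (Y₁ ⧸ W) →ₗ[Aᵐᵒᵖ] X := W.liftQ g (fun y hy => hN y hy)
    have hF : Function.Injective F := by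
      rw [injective_iff_map_eq_zero]
      intro z hz
      obtain ⟨y, rfl⟩ := Submodule.Quotient.mk_surjective _ z
      rw [Submodule.Quotient.mk_eq_zero]
      exact (Submodule.Quotient.mk_eq_zero N).1 hz
    let F' : (Y₁ ⧸ W) →ₗ[(G.ringCon.Quotient)ᵐᵒᵖ] (Y ⧸ N) :=
      { toFun := F
        map_add' := map_add F
        map_smul' := by
          intro s z
          obtain ⟨a, ha⟩ := hs s.unop
          obtain rfl : op (RingCon.mk' G.ringCon a) = s := by rw [ha]; rfl
          simp only [RingHom.id_apply]
          rw [hm, hm1, map_smul] }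
    let K' : (Y₁ ⧸ W) →ₗ[(G.ringCon.Quotient)ᵐᵒᵖ] X :=
      { toFun := K
        map_add' := map_add K
        map_smul' := by
          intro s z
          obtain ⟨a, ha⟩ := hs s.unop
          obtain rfl : op (RingCon.mk' G.ringCon a) = s := by rw [ha]; rfl
          simp only [RingHom.id_apply]
          rw [hc, hm1, map_smul] }
    obtain ⟨H, hH⟩ := hI.out F' hF K'
    refine ⟨{ toFun := fun y => H (Submodule.Quotient.mk y)
              map_add' := fun a b => by rw [Submodule.Quotient.mk_add, map_add]
              map_smul' := ?_ }, ?_⟩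
    · intro a y
      simp only [RingHom.id_apply]
      rw [Submodule.Quotient.mk_smul, ← op_unop a, ← hm, map_smul, hc]
    · intro y
      exact hH (Submodule.Quotient.mk y)
  · intro hI
    refine ⟨?_⟩
    intro Y₁ Y _ _ _ _ f hf g
    letI i1 : Module Aᵐᵒᵖ Y₁ := Module.compHom Y₁ (RingHom.op (RingCon.mk' G.ringCon))
    letI i2 : Module Aᵐᵒᵖ Y := Module.compHom Y (RingHom.op (RingCon.mk' G.ringCon))
    have h1 : ∀ (a : Aᵐᵒᵖ) (y : Y₁), a • y = op (RingCon.mk' G.ringCon a.unop) • y :=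
      fun _ _ => rfl
    have h2 : ∀ (a : Aᵐᵒᵖ) (y : Y), a • y = op (RingCon.mk' G.ringCon a.unop) • y :=
      fun _ _ => rfl
    let F : Y₁ →ₗ[Aᵐᵒᵖ] Y :=
      { toFun := f
        map_add' := map_add f
        map_smul' := by
          intro a y
          simp only [RingHom.id_apply]
          rw [h1, h2, map_smul] }
    let K : Y₁ →ₗ[Aᵐᵒᵖ] X :=
      { toFun := g
        map_add' := map_add g
        map_smul' := by
          intro a y
          simp only [RingHom.id_apply]
          rw [h1, map_smul, hc, op_unop] }
    obtain ⟨H, hH⟩ := hI.out F hf K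
    refine ⟨{ toFun := H
              map_add' := map_add H
              map_smul' := ?_ }, hH⟩
    intro s y
    obtain ⟨a, ha⟩ := hs s.unop
    obtain rfl : op (RingCon.mk' G.ringCon a) = s := by rw [ha]; rfl
    simp only [RingHom.id_apply]
    rw [hc, ← map_smul, h2, unop_op]
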